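/- arXiv:1809.00656 — 3 statements merged into one kernel-verified Lean document; each statement's English description precedes it below -/
import Mathlib

section
/- Let Γ be a finite L2⁺ theory and φ an L2⁺ sentence. If Γ ⊨ φ, then there is a proof tree of φ over Γ in the L2⁺ proof system all of whose sentences belong to g(Γ ∪ {φ}). -/
inductive Tm (P R : Type) : Type
  | noun : P → Tm P R
  | allT : R → Tm P R → Tm P R

/-- Sentences of L2⁺: (all x y), (some x y), and the four-place
disjunctive sentence (all a b ∨ some x y). -/
inductive SentP (P R : Type) : Type
  | allS : Tm P R → Tm P R → SentP P R
  | someS : Tm P R → Tm P R → SentP P R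
  | orS : Tm P R → Tm P R → Tm P R → Tm P R → SentP P R

structure Model (P R : Type) where
  W : Type
  nounI : P → Set W
  verbI : R → W → W → Prop

def Tm.interp {P R : Type} (M : Model P R) : Tm P R → Set M.W
  | .noun p => M.nounI p
  | .allT r x => {m | ∀ n ∈ Tm.interp M x, M.verbI r m n}

def Model.sat {P R : Type} (M : Model P R) : SentP P R → Prop
  | .allS x y => Tm.interp M x ⊆ Tm.interp M y
  | .someS x y => (Tm.interp M x ∩ Tm.interp M y).Nonempty
  | .orS a b x y => Tm.interp M a ⊆ Tm.interp M b ∨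
      (Tm.interp M x ∩ Tm.interp M y).Nonempty

def entails {P R : Type} (Γ : Set (SentP P R)) (φ : SentP P R) : Prop :=
  ∀ M : Model P R, (∀ ψ ∈ Γ, M.sat ψ) → M.sat φ

def Tm.subterms {P R : Type} : Tm P R → Set (Tm P R)
  | .noun p => {Tm.noun p}
  | .allT r x => insert (Tm.allT r x) (Tm.subterms x)

def Tm.verbs {P R : Type} : Tm P R → Set R
  | .noun _ => ∅
  | .allT r x => insert r (Tm.verbs x)

def SentP.subterms {P R : Type} : SentP P R → Set (Tm P R)
  | .allS x y => x.subterms ∪ y.subterms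
  | .someS x y => x.subterms ∪ y.subterms
  | .orS a b x y => a.subterms ∪ b.subterms ∪ x.subterms ∪ y.subterms

def SentP.verbs {P R : Type} : SentP P R → Set R
  | .allS x y => x.verbs ∪ y.verbs
  | .someS x y => x.verbs ∪ y.verbs
  | .orS a b x y => a.verbs ∪ b.verbs ∪ x.verbs ∪ y.verbs

/-- T(Δ): the set of subterms of sentences in Δ. -/
def Tset {P R : Type} (Δ : Set (SentP P R)) : Set (Tm P R) :=
  {t | ∃ φ ∈ Δ, t ∈ SentP.subterms φ}

/-- T⁺(Δ) = T(Δ) ∪ {(r all w) : w ∈ T(Δ), r a verb occurring in Δ}. -/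
def Tplus {P R : Type} (Δ : Set (SentP P R)) : Set (Tm P R) :=
  Tset Δ ∪ {t | ∃ r : R, (∃ φ ∈ Δ, r ∈ SentP.verbs φ) ∧ ∃ w ∈ Tset Δ, t = Tm.allT r w}

/-- g(Δ): all sentences (all x y) with x ∈ T(Δ), y ∈ T⁺(Δ); all (some u v) with
u, v ∈ T(Δ); and all (all x y ∨ some u v) with x, u, v ∈ T(Δ), y ∈ T⁺(Δ). -/
def gSet {P R : Type} (Δ : Set (SentP P R)) : Set (SentP P R) :=
  {s | (∃ x ∈ Tset Δ, ∃ y ∈ Tplus Δ, s = SentP.allS x y) ∨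
       (∃ u ∈ Tset Δ, ∃ v ∈ Tset Δ, s = SentP.someS u v) ∨
       (∃ x ∈ Tset Δ, ∃ y ∈ Tplus Δ, ∃ u ∈ Tset Δ, ∃ v ∈ Tset Δ, s = SentP.orS x y u v)}

/-- Γ ⊢_A φ in the L2⁺ proof system: a proof tree over Γ with root φ, all of whose
sentences belong to A. -/
inductive PrIn {P R : Type} (A Γ : Set (SentP P R)) : SentP P R → Prop
  | hyp {φ} : φ ∈ Γ → φ ∈ A → PrIn A Γ φ
  | ax (x : Tm P R) : SentP.allS x x ∈ A → PrIn A Γ (SentP.allS x x)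
  | barbara {x y z} : PrIn A Γ (SentP.allS x y) → PrIn A Γ (SentP.allS y z) →
      SentP.allS x z ∈ A → PrIn A Γ (SentP.allS x z)
  | anti {x y} (r : R) : PrIn A Γ (SentP.allS x y) →
      SentP.allS (Tm.allT r y) (Tm.allT r x) ∈ A →
      PrIn A Γ (SentP.allS (Tm.allT r y) (Tm.allT r x))
  | some1 {x y} : PrIn A Γ (SentP.someS x y) →
      SentP.someS x x ∈ A → PrIn A Γ (SentP.someS x x)
  | some2 {x y} : PrIn A Γ (SentP.someS x y) →
      SentP.someS y x ∈ A → PrIn A Γ (SentP.someS y x)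
  | darii {x y z} : PrIn A Γ (SentP.someS x y) → PrIn A Γ (SentP.allS y z) →
      SentP.someS x z ∈ A → PrIn A Γ (SentP.someS x z)
  | empty1 (a b : Tm P R) : SentP.orS a b a a ∈ A → PrIn A Γ (SentP.orS a b a a)
  | empty2 (a b : Tm P R) (r : R) : SentP.orS b (Tm.allT r a) a a ∈ A →
      PrIn A Γ (SentP.orS b (Tm.allT r a) a a)
  | lweak {a b} (x y : Tm P R) : PrIn A Γ (SentP.allS a b) →
      SentP.orS a b x y ∈ A → PrIn A Γ (SentP.orS a b x y)
  | rweak {x y} (a b : Tm P R) : PrIn A Γ (SentP.someS x y) →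
      SentP.orS a b x y ∈ A → PrIn A Γ (SentP.orS a b x y)
  | some1d {a b x y} : PrIn A Γ (SentP.orS a b x y) →
      SentP.orS a b x x ∈ A → PrIn A Γ (SentP.orS a b x x)
  | some2d {a b x y} : PrIn A Γ (SentP.orS a b x y) →
      SentP.orS a b y x ∈ A → PrIn A Γ (SentP.orS a b y x)
  | barbarad {a b c x y} : PrIn A Γ (SentP.orS a b x y) → PrIn A Γ (SentP.orS b c x y) →
      SentP.orS a c x y ∈ A → PrIn A Γ (SentP.orS a c x y)
  | antid {a b x y} (r : R) : PrIn A Γ (SentP.orS a b x y) →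
      SentP.orS (Tm.allT r b) (Tm.allT r a) x y ∈ A →
      PrIn A Γ (SentP.orS (Tm.allT r b) (Tm.allT r a) x y)
  | ddarii {t u x y} : PrIn A Γ (SentP.someS t u) →
      PrIn A Γ (SentP.orS t x x y) → PrIn A Γ (SentP.orS u y x y) →
      SentP.someS x y ∈ A → PrIn A Γ (SentP.someS x y)
  | ddariid {a b t u x y} : PrIn A Γ (SentP.orS a b t u) →
      PrIn A Γ (SentP.orS t x x y) → PrIn A Γ (SentP.orS u y x y) →
      SentP.orS a b x y ∈ A → PrIn A Γ (SentP.orS a b x y)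

theorem Tm.self_mem {P R : Type} (t : Tm P R) : t ∈ t.subterms := by
  cases t <;> simp [Tm.subterms]

theorem Tm.sub_closed {P R : Type} (t : Tm P R) (r : R) (v : Tm P R)
    (h : Tm.allT r v ∈ t.subterms) : v ∈ t.subterms := by
  induction t with
  | noun p => simp [Tm.subterms] at h
  | allT s x ih =>
    simp only [Tm.subterms, Set.mem_insert_iff] at h ⊢
    rcases h with h | h
    · cases h
      exact Or.inr (Tm.self_mem _)
    · exact Or.inr (ih h)

theorem Tset_closed {P R : Type} (Δ : Set (SentP P R)) (r : R) (v : Tm P R)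
    (h : Tm.allT r v ∈ Tset Δ) : v ∈ Tset Δ := by
  obtain ⟨φ, hφ, h⟩ := h
  refine ⟨φ, hφ, ?_⟩
  cases φ <;> simp only [SentP.subterms, Set.mem_union] at h ⊢
  · exact h.imp (Tm.sub_closed _ r v) (Tm.sub_closed _ r v)
  · exact h.imp (Tm.sub_closed _ r v) (Tm.sub_closed _ r v)
  · exact h.imp (Or.imp (Or.imp (Tm.sub_closed _ r v) (Tm.sub_closed _ r v))
      (Tm.sub_closed _ r v)) (Tm.sub_closed _ r v)

/-- The model whose points are admissible pairs of terms. -/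
def pairModel {P R : Type} (T : Set (Tm P R)) (le : Tm P R → Tm P R → Prop)
    (pt : Tm P R → Tm P R → Prop) : Model P R where
  W := {p : Tm P R × Tm P R // p.1 ∈ T ∧ p.2 ∈ T ∧ pt p.1 p.2}
  nounI n := {m | le m.1.1 (.noun n) ∨ le m.1.2 (.noun n)}
  verbI r m n := ∃ w, Tm.allT r w ∈ T ∧ (le n.1.1 w ∨ le n.1.2 w) ∧
    (le m.1.1 (.allT r w) ∨ le m.1.2 (.allT r w))

theorem pair_truth {P R : Type} (T : Set (Tm P R)) (le : Tm P R → Tm P R → Prop)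
    (pt : Tm P R → Tm P R → Prop)
    (hcl : ∀ r v, Tm.allT r v ∈ T → v ∈ T)
    (hrefl : ∀ t ∈ T, le t t)
    (htrans : ∀ a ∈ T, ∀ b ∈ T, ∀ c ∈ T, le a b → le b c → le a c)
    (hanti : ∀ r v w, Tm.allT r v ∈ T → Tm.allT r w ∈ T → le v w →
      le (.allT r w) (.allT r v))
    (hempty : ∀ r v, Tm.allT r v ∈ T → ¬ pt v v → ∀ t ∈ T, le t (.allT r v))
    (v : Tm P R) (hv : v ∈ T) (m : (pairModel T le pt).W) :
    m ∈ Tm.interp (pairModel T le pt) v ↔ (le m.1.1 v ∨ le m.1.2 v) := by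
  induction v generalizing m with
  | noun p => rfl
  | allT r v ih =>
    have hvT := hcl r v hv
    constructor
    · intro h
      by_cases hp : pt v v
      · obtain ⟨w, hw, h1, h2⟩ := h ⟨(v, v), hvT, hvT, hp⟩
          ((ih hvT _).2 (Or.inl (hrefl v hvT)))
        have h1 : le v w := h1.elim id id
        have h3 := hanti r v w hv hw h1
        exact h2.imp (fun h => htrans _ m.2.1 _ hw _ hv h h3)
          (fun h => htrans _ m.2.2.1 _ hw _ hv h h3)
      · exact Or.inl (hempty r v hv hp _ m.2.1)
    · intro h n hn
      exact ⟨v, hv, (ih hvT n).1 hn, h⟩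

section
variable {P R : Type} {Δ Γ : Set (SentP P R)}

theorem mem_all {a b : Tm P R} (ha : a ∈ Tset Δ) (hb : b ∈ Tset Δ) :
    SentP.allS a b ∈ gSet Δ := Or.inl ⟨a, ha, b, Or.inl hb, rfl⟩

theorem mem_some {a b : Tm P R} (ha : a ∈ Tset Δ) (hb : b ∈ Tset Δ) :
    SentP.someS a b ∈ gSet Δ := Or.inr (Or.inl ⟨a, ha, b, hb, rfl⟩)

theorem mem_or {a b x y : Tm P R} (ha : a ∈ Tset Δ) (hb : b ∈ Tset Δ) (hx : x ∈ Tset Δ)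
    (hy : y ∈ Tset Δ) : SentP.orS a b x y ∈ gSet Δ :=
  Or.inr (Or.inr ⟨a, ha, b, Or.inl hb, x, hx, y, hy, rfl⟩)

theorem ters_all {a b : Tm P R} (h : SentP.allS a b ∈ Δ) : a ∈ Tset Δ ∧ b ∈ Tset Δ :=
  ⟨⟨_, h, Or.inl a.self_mem⟩, ⟨_, h, Or.inr b.self_mem⟩⟩

theorem ters_some {a b : Tm P R} (h : SentP.someS a b ∈ Δ) : a ∈ Tset Δ ∧ b ∈ Tset Δ :=
  ⟨⟨_, h, Or.inl a.self_mem⟩, ⟨_, h, Or.inr b.self_mem⟩⟩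

theorem ters_or {a b x y : Tm P R} (h : SentP.orS a b x y ∈ Δ) :
    a ∈ Tset Δ ∧ b ∈ Tset Δ ∧ x ∈ Tset Δ ∧ y ∈ Tset Δ :=
  ⟨⟨_, h, Or.inl (Or.inl (Or.inl a.self_mem))⟩, ⟨_, h, Or.inl (Or.inl (Or.inr b.self_mem))⟩,
   ⟨_, h, Or.inl (Or.inr x.self_mem)⟩, ⟨_, h, Or.inr y.self_mem⟩⟩

/-- Case of a universal conclusion. -/
theorem case_all (hΓ : Γ ⊆ Δ) {a b : Tm P R} (ha : a ∈ Tset Δ) (hb : b ∈ Tset Δ)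
    (h : entails Γ (.allS a b)) : PrIn (gSet Δ) Γ (.allS a b) := by
  let le : Tm P R → Tm P R → Prop := fun c d => PrIn (gSet Δ) Γ (.allS c d)
  let pt : Tm P R → Tm P R → Prop := fun _ _ => True
  have hrefl : ∀ t ∈ Tset Δ, le t t := fun t ht => .ax t (mem_all ht ht)
  have htrans : ∀ a ∈ Tset Δ, ∀ b ∈ Tset Δ, ∀ c ∈ Tset Δ, le a b → le b c → le a c :=
    fun a ha b _ c hc h1 h2 => .barbara h1 h2 (mem_all ha hc)
  have tr := pair_truth (Tset Δ) le pt (Tset_closed Δ) hrefl htrans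
    (fun r v w hv hw h => .anti r h (mem_all hw hv)) (fun _ _ _ h => absurd trivial h)
  have hall : ∀ c ∈ Tset Δ, ∀ d ∈ Tset Δ, le c d →
      Tm.interp (pairModel (Tset Δ) le pt) c ⊆ Tm.interp (pairModel (Tset Δ) le pt) d := by
    intro c hc d hd hcd m hm
    rw [tr c hc] at hm
    rw [tr d hd]
    exact hm.imp (fun h => htrans _ m.2.1 _ hc _ hd h hcd)
      (fun h => htrans _ m.2.2.1 _ hc _ hd h hcd)
  have hsome : ∀ c ∈ Tset Δ, ∀ d ∈ Tset Δ, (Tm.interp (pairModel (Tset Δ) le pt) c ∩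
      Tm.interp (pairModel (Tset Δ) le pt) d).Nonempty := by
    intro c hc d hd
    exact ⟨⟨(c, d), hc, hd, trivial⟩, (tr c hc _).2 (Or.inl (hrefl c hc)),
      (tr d hd _).2 (Or.inr (hrefl d hd))⟩
  have := h (pairModel (Tset Δ) le pt) (by
    intro ψ hψ
    cases ψ with
    | allS c d =>
      obtain ⟨hc, hd⟩ := ters_all (hΓ hψ)
      exact hall c hc d hd (.hyp hψ (mem_all hc hd))
    | someS c d =>
      obtain ⟨hc, hd⟩ := ters_some (hΓ hψ)
      exact hsome c hc d hd
    | orS c d x y =>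
      obtain ⟨hc, hd, hx, hy⟩ := ters_or (hΓ hψ)
      exact Or.inr (hsome x hx y hy))
  have h2 := (tr b hb ⟨(a, a), ha, ha, trivial⟩).1 (this ((tr a ha _).2 (Or.inl (hrefl a ha))))
  exact h2.elim id id

/-- Dual Darii for all arrangements of the two witnesses. -/
theorem or_lift {a b t u x y : Tm P R} (ha : a ∈ Tset Δ) (hb : b ∈ Tset Δ)
    (ht : t ∈ Tset Δ) (hu : u ∈ Tset Δ) (hx : x ∈ Tset Δ) (hy : y ∈ Tset Δ)
    (hab : PrIn (gSet Δ) Γ (.orS a b t u))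
    (h1 : PrIn (gSet Δ) Γ (.orS t x x y) ∨ PrIn (gSet Δ) Γ (.orS u x x y))
    (h2 : PrIn (gSet Δ) Γ (.orS t y x y) ∨ PrIn (gSet Δ) Γ (.orS u y x y)) :
    PrIn (gSet Δ) Γ (.orS a b x y) := by
  have m := mem_or ha hb hx hy
  have hs : PrIn (gSet Δ) Γ (.orS a b u t) := .some2d hab (mem_or ha hb hu ht)
  rcases h1 with h1 | h1 <;> rcases h2 with h2 | h2
  · exact .ddariid (.some1d hab (mem_or ha hb ht ht)) h1 h2 m
  · exact .ddariid hab h1 h2 m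
  · exact .ddariid hs h1 h2 m
  · exact .ddariid (.some1d hs (mem_or ha hb hu hu)) h1 h2 m

theorem some_lift {t u x y : Tm P R}
    (ht : t ∈ Tset Δ) (hu : u ∈ Tset Δ) (hx : x ∈ Tset Δ) (hy : y ∈ Tset Δ)
    (hab : PrIn (gSet Δ) Γ (.someS t u))
    (h1 : PrIn (gSet Δ) Γ (.orS t x x y) ∨ PrIn (gSet Δ) Γ (.orS u x x y))
    (h2 : PrIn (gSet Δ) Γ (.orS t y x y) ∨ PrIn (gSet Δ) Γ (.orS u y x y)) :
    PrIn (gSet Δ) Γ (.someS x y) := by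
  have m := mem_some hx hy
  have hs : PrIn (gSet Δ) Γ (.someS u t) := .some2 hab (mem_some hu ht)
  rcases h1 with h1 | h1 <;> rcases h2 with h2 | h2
  · exact .ddarii (.some1 hab (mem_some ht ht)) h1 h2 m
  · exact .ddarii hab h1 h2 m
  · exact .ddarii hs h1 h2 m
  · exact .ddarii (.some1 hs (mem_some hu hu)) h1 h2 m

/-- If (some x y) is not provable, there is a model of Γ in which (some x y) fails, and whose
universal sentences are all provable with disjunct (some x y). -/
theorem case_some (hΓ : Γ ⊆ Δ) {x y : Tm P R} (hx : x ∈ Tset Δ) (hy : y ∈ Tset Δ)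
    (hn : ¬ PrIn (gSet Δ) Γ (.someS x y)) :
    ∃ M : Model P R, (∀ ψ ∈ Γ, M.sat ψ) ∧ ¬ M.sat (.someS x y) ∧
      ∀ a ∈ Tset Δ, ∀ b ∈ Tset Δ, M.sat (.allS a b) → PrIn (gSet Δ) Γ (.orS a b x y) := by
  classical
  let le : Tm P R → Tm P R → Prop := fun c d => PrIn (gSet Δ) Γ (.orS c d x y)
  let pt : Tm P R → Tm P R → Prop := fun t u => ¬ ((le t x ∨ le u x) ∧ (le t y ∨ le u y))
  have hrefl : ∀ t ∈ Tset Δ, le t t := fun t ht =>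
    .lweak x y (.ax t (mem_all ht ht)) (mem_or ht ht hx hy)
  have htrans : ∀ a ∈ Tset Δ, ∀ b ∈ Tset Δ, ∀ c ∈ Tset Δ, le a b → le b c → le a c :=
    fun a ha b _ c hc h1 h2 => .barbarad h1 h2 (mem_or ha hc hx hy)
  have tr := pair_truth (Tset Δ) le pt (Tset_closed Δ) hrefl htrans
    (fun r v w hv hw h => .antid r h (mem_or hw hv hx hy))
    (fun r v hv hp t ht => by
      have hvT := Tset_closed Δ r v hv
      obtain ⟨h1, h2⟩ := not_not.1 hp
      exact or_lift ht hv hvT hvT hx hy (.empty2 v t r (mem_or ht hv hvT hvT)) h1 h2)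
  have hall : ∀ c ∈ Tset Δ, ∀ d ∈ Tset Δ, le c d →
      Tm.interp (pairModel (Tset Δ) le pt) c ⊆ Tm.interp (pairModel (Tset Δ) le pt) d := by
    intro c hc d hd hcd m hm
    rw [tr c hc] at hm
    rw [tr d hd]
    exact hm.imp (fun h => htrans _ m.2.1 _ hc _ hd h hcd)
      (fun h => htrans _ m.2.2.1 _ hc _ hd h hcd)
  have hsome : ∀ c ∈ Tset Δ, ∀ d ∈ Tset Δ, pt c d → (Tm.interp (pairModel (Tset Δ) le pt) c ∩
      Tm.interp (pairModel (Tset Δ) le pt) d).Nonempty := by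
    intro c hc d hd hp
    exact ⟨⟨(c, d), hc, hd, hp⟩, (tr c hc _).2 (Or.inl (hrefl c hc)),
      (tr d hd _).2 (Or.inr (hrefl d hd))⟩
  refine ⟨pairModel (Tset Δ) le pt, ?_, ?_, ?_⟩
  · intro ψ hψ
    cases ψ with
    | allS c d =>
      obtain ⟨hc, hd⟩ := ters_all (hΓ hψ)
      exact hall c hc d hd (.lweak x y (.hyp hψ (mem_all hc hd)) (mem_or hc hd hx hy))
    | someS c d =>
      obtain ⟨hc, hd⟩ := ters_some (hΓ hψ)
      exact hsome c hc d hd fun hp =>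
        hn (some_lift hc hd hx hy (.hyp hψ (mem_some hc hd)) hp.1 hp.2)
    | orS c d t u =>
      obtain ⟨hc, hd, ht, hu⟩ := ters_or (hΓ hψ)
      by_cases hp : pt t u
      · exact Or.inr (hsome t ht u hu hp)
      · obtain ⟨h1, h2⟩ := not_not.1 hp
        exact Or.inl (hall c hc d hd
          (or_lift hc hd ht hu hx hy (.hyp hψ (mem_or hc hd ht hu)) h1 h2))
  · rintro ⟨m, hm1, hm2⟩
    exact m.2.2.2 ⟨(tr x hx m).1 hm1, (tr y hy m).1 hm2⟩
  · intro a ha b hb hab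
    by_cases hp : pt a a
    · have h2 := (tr b hb ⟨(a, a), ha, ha, hp⟩).1 (hab ((tr a ha _).2 (Or.inl (hrefl a ha))))
      exact h2.elim id id
    · obtain ⟨h1, h2⟩ := not_not.1 hp
      exact or_lift ha hb ha ha hx hy (.empty1 a b (mem_or ha hb ha ha)) h1 h2

end

/-- If Γ is a finite L2⁺ theory with Γ ⊨ φ, then there is a proof tree of φ over Γ
in the L2⁺ proof system all of whose sentences belong to g(Γ ∪ {φ}). -/
theorem stmt14 {P R : Type} (Γ : Set (SentP P R)) (φ : SentP P R)
    (hfin : Γ.Finite) (h : entails Γ φ) :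
    PrIn (gSet (Γ ∪ {φ})) Γ φ := by
  have hΓ : Γ ⊆ Γ ∪ {φ} := Set.subset_union_left
  have hφ : φ ∈ Γ ∪ {φ} := Or.inr rfl
  generalize Γ ∪ {φ} = Δ at hΓ hφ
  cases φ with
  | allS a b =>
    obtain ⟨ha, hb⟩ := ters_all hφ
    exact case_all hΓ ha hb h
  | someS x y =>
    obtain ⟨hx, hy⟩ := ters_some hφ
    by_contra hn
    obtain ⟨M, h1, h2, -⟩ := case_some hΓ hx hy hn
    exact h2 (h M h1)
  | orS a b x y =>
    obtain ⟨ha, hb, hx, hy⟩ := ters_or hφ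
    by_cases hn : PrIn (gSet Δ) Γ (.someS x y)
    · exact .rweak a b hn (mem_or ha hb hx hy)
    · obtain ⟨M, h1, h2, h3⟩ := case_some hΓ hx hy hn
      rcases h M h1 with h4 | h4
      · exact h3 a ha b hb h4
      · exact absurd h4 h2
end

section
/- The L3.5 proof system is sound and complete: for any L3.5 theory Γ and sentence φ, Γ ⊨ φ if and only if Γ ⊢ φ. -/
/-- Terms of L3.5: nouns, (r all x), and (r some x). -/
inductive Tm3 (P R : Type) : Type
  | noun : P → Tm3 P R
  | allT : R → Tm3 P R → Tm3 P R
  | someT : R → Tm3 P R → Tm3 P R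

/-- Sentences of L3.5: (all x y) and (some x y). -/
inductive Sent35 (P R : Type) : Type
  | allS : Tm3 P R → Tm3 P R → Sent35 P R
  | someS : Tm3 P R → Tm3 P R → Sent35 P R

structure Model3 (P R : Type) where
  W : Type
  nounI : P → Set W
  verbI : R → W → W → Prop

def Tm3.interp {P R : Type} (M : Model3 P R) : Tm3 P R → Set M.W
  | .noun p => M.nounI p
  | .allT r x => {m | ∀ n ∈ Tm3.interp M x, M.verbI r m n}
  | .someT r x => {m | ∃ n ∈ Tm3.interp M x, M.verbI r m n}

def Model3.sat {P R : Type} (M : Model3 P R) : Sent35 P R → Prop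
  | .allS x y => Tm3.interp M x ⊆ Tm3.interp M y
  | .someS x y => (Tm3.interp M x ∩ Tm3.interp M y).Nonempty

def entails35 {P R : Type} (Γ : Set (Sent35 P R)) (φ : Sent35 P R) : Prop :=
  ∀ M : Model3 P R, (∀ ψ ∈ Γ, M.sat ψ) → M.sat φ

/-- The L3.5 proof system: the ⊢₀ rules together with (R1), (R2), (R3), and the
assumption-withdrawing rules (Cases) and (Cases₁). -/
inductive Pr35 {P R : Type} : Set (Sent35 P R) → Sent35 P R → Prop
  | hyp {Γ : Set (Sent35 P R)} {φ} : φ ∈ Γ → Pr35 Γ φ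
  | ax {Γ : Set (Sent35 P R)} (x : Tm3 P R) : Pr35 Γ (Sent35.allS x x)
  | barbara {Γ : Set (Sent35 P R)} {x y z} : Pr35 Γ (Sent35.allS x y) →
      Pr35 Γ (Sent35.allS y z) → Pr35 Γ (Sent35.allS x z)
  | anti {Γ : Set (Sent35 P R)} {x y} (r : R) : Pr35 Γ (Sent35.allS x y) →
      Pr35 Γ (Sent35.allS (Tm3.allT r y) (Tm3.allT r x))
  | some1 {Γ : Set (Sent35 P R)} {x y} : Pr35 Γ (Sent35.someS x y) →
      Pr35 Γ (Sent35.someS x x)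
  | some2 {Γ : Set (Sent35 P R)} {x y} : Pr35 Γ (Sent35.someS x y) →
      Pr35 Γ (Sent35.someS y x)
  | darii {Γ : Set (Sent35 P R)} {x y z} : Pr35 Γ (Sent35.someS x y) →
      Pr35 Γ (Sent35.allS y z) → Pr35 Γ (Sent35.someS x z)
  | r1 {Γ : Set (Sent35 P R)} {x y} (r : R) : Pr35 Γ (Sent35.allS x y) →
      Pr35 Γ (Sent35.allS (Tm3.someT r x) (Tm3.someT r y))
  | r2 {Γ : Set (Sent35 P R)} {x y} (r : R) : Pr35 Γ (Sent35.someS x y) →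
      Pr35 Γ (Sent35.allS (Tm3.allT r x) (Tm3.someT r y))
  | r3 {Γ : Set (Sent35 P R)} {x y} (r : R) :
      Pr35 Γ (Sent35.someS x (Tm3.someT r y)) → Pr35 Γ (Sent35.someS y y)
  | cases {Γ : Set (Sent35 P R)} {φ} (x y : Tm3 P R) (r : R) :
      Pr35 (insert (Sent35.someS x x) Γ) φ →
      Pr35 (insert (Sent35.allS y (Tm3.allT r x)) Γ) φ →
      Pr35 Γ φ
  | cases1 {Γ : Set (Sent35 P R)} {φ} (x y : Tm3 P R) :
      Pr35 (insert (Sent35.someS x x) Γ) φ →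
      Pr35 (insert (Sent35.allS x y) Γ) φ →
      Pr35 Γ φ

theorem Pr35.mono {P R : Type} {Γ : Set (Sent35 P R)} {φ} (h : Pr35 Γ φ) :
    ∀ {Δ : Set (Sent35 P R)}, Γ ⊆ Δ → Pr35 Δ φ := by
  induction h with
  | hyp h => intro Δ hs; exact .hyp (hs h)
  | ax x => intro Δ hs; exact .ax x
  | barbara _ _ i j => intro Δ hs; exact .barbara (i hs) (j hs)
  | anti r _ i => intro Δ hs; exact .anti r (i hs)
  | some1 _ i => intro Δ hs; exact .some1 (i hs)
  | some2 _ i => intro Δ hs; exact .some2 (i hs)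
  | darii _ _ i j => intro Δ hs; exact .darii (i hs) (j hs)
  | r1 r _ i => intro Δ hs; exact .r1 r (i hs)
  | r2 r _ i => intro Δ hs; exact .r2 r (i hs)
  | r3 r _ i => intro Δ hs; exact .r3 r (i hs)
  | cases x y r _ _ i j =>
    intro Δ hs
    exact .cases x y r (i (Set.insert_subset_insert hs)) (j (Set.insert_subset_insert hs))
  | cases1 x y _ _ i j =>
    intro Δ hs
    exact .cases1 x y (i (Set.insert_subset_insert hs)) (j (Set.insert_subset_insert hs))

theorem Pr35.fin {P R : Type} {Γ : Set (Sent35 P R)} {φ} (h : Pr35 Γ φ) :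
    ∃ F : Set (Sent35 P R), F.Finite ∧ F ⊆ Γ ∧ Pr35 F φ := by
  induction h with
  | hyp h => exact ⟨{_}, Set.finite_singleton _, by simpa using h, .hyp rfl⟩
  | ax x => exact ⟨∅, Set.finite_empty, by simp, .ax x⟩
  | barbara _ _ i j =>
    obtain ⟨F, hF, hs, h⟩ := i
    obtain ⟨G, hG, ht, k⟩ := j
    exact ⟨F ∪ G, hF.union hG, Set.union_subset hs ht,
      .barbara (h.mono Set.subset_union_left) (k.mono Set.subset_union_right)⟩
  | anti r _ i => obtain ⟨F, hF, hs, h⟩ := i; exact ⟨F, hF, hs, .anti r h⟩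
  | some1 _ i => obtain ⟨F, hF, hs, h⟩ := i; exact ⟨F, hF, hs, .some1 h⟩
  | some2 _ i => obtain ⟨F, hF, hs, h⟩ := i; exact ⟨F, hF, hs, .some2 h⟩
  | darii _ _ i j =>
    obtain ⟨F, hF, hs, h⟩ := i
    obtain ⟨G, hG, ht, k⟩ := j
    exact ⟨F ∪ G, hF.union hG, Set.union_subset hs ht,
      .darii (h.mono Set.subset_union_left) (k.mono Set.subset_union_right)⟩
  | r1 r _ i => obtain ⟨F, hF, hs, h⟩ := i; exact ⟨F, hF, hs, .r1 r h⟩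
  | r2 r _ i => obtain ⟨F, hF, hs, h⟩ := i; exact ⟨F, hF, hs, .r2 r h⟩
  | r3 r _ i => obtain ⟨F, hF, hs, h⟩ := i; exact ⟨F, hF, hs, .r3 r h⟩
  | @cases Γ φ x y r _ _ i j =>
    obtain ⟨F, hF, hs, h⟩ := i
    obtain ⟨G, hG, ht, k⟩ := j
    refine ⟨(F ∪ G) ∩ Γ, (hF.union hG).inter_of_left _, Set.inter_subset_right, 
      .cases x y r (h.mono ?_) (k.mono ?_)⟩
    · intro a ha; rcases hs ha with e | e
      · exact Or.inl e
      · exact Or.inr ⟨Or.inl ha, e⟩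
    · intro a ha; rcases ht ha with e | e
      · exact Or.inl e
      · exact Or.inr ⟨Or.inr ha, e⟩
  | @cases1 Γ φ x y _ _ i j =>
    obtain ⟨F, hF, hs, h⟩ := i
    obtain ⟨G, hG, ht, k⟩ := j
    refine ⟨(F ∪ G) ∩ Γ, (hF.union hG).inter_of_left _, Set.inter_subset_right, 
      .cases1 x y (h.mono ?_) (k.mono ?_)⟩
    · intro a ha; rcases hs ha with e | e
      · exact Or.inl e
      · exact Or.inr ⟨Or.inl ha, e⟩
    · intro a ha; rcases ht ha with e | e
      · exact Or.inl e
      · exact Or.inr ⟨Or.inr ha, e⟩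

theorem Pr35.sound {P R : Type} {Γ : Set (Sent35 P R)} {φ} (h : Pr35 Γ φ) :
    entails35 Γ φ := by
  induction h with
  | hyp h => intro M hM; exact hM _ h
  | ax x => intro M hM a ha; exact ha
  | barbara _ _ i j => intro M hM a ha; exact j M hM (i M hM ha)
  | anti r _ i => intro M hM a ha b hb; exact ha b (i M hM hb)
  | some1 _ i => intro M hM; obtain ⟨a, h, k⟩ := i M hM; exact ⟨a, h, h⟩
  | some2 _ i => intro M hM; obtain ⟨a, h, k⟩ := i M hM; exact ⟨a, k, h⟩
  | darii _ _ i j => intro M hM; obtain ⟨a, h, k⟩ := i M hM; exact ⟨a, h, j M hM k⟩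
  | r1 r _ i => intro M hM a ha; obtain ⟨b, h, k⟩ := ha; exact ⟨b, i M hM h, k⟩
  | r2 r _ i => intro M hM a ha; obtain ⟨b, h, k⟩ := i M hM; exact ⟨b, k, ha b h⟩
  | r3 r _ i => intro M hM; obtain ⟨a, h, b, k, l⟩ := i M hM; exact ⟨b, k, k⟩
  | cases x y r _ _ i j =>
    intro M hM
    by_cases hx : (Tm3.interp M x).Nonempty
    · obtain ⟨a, ha⟩ := hx
      refine i M ?_
      rintro ψ (rfl | h)
      · exact ⟨a, ha, ha⟩
      · exact hM _ h
    · refine j M ?_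
      rintro ψ (rfl | h)
      · intro a _ b hb; exact absurd ⟨b, hb⟩ hx
      · exact hM _ h
  | cases1 x y _ _ i j =>
    intro M hM
    by_cases hx : (Tm3.interp M x).Nonempty
    · obtain ⟨a, ha⟩ := hx
      refine i M ?_
      rintro ψ (rfl | h)
      · exact ⟨a, ha, ha⟩
      · exact hM _ h
    · refine j M ?_
      rintro ψ (rfl | h)
      · intro a ha; exact absurd ⟨a, ha⟩ hx
      · exact hM _ h

/-- Worlds of the canonical model: two copies of each pair with (some x y) provable. -/
structure CanW {P R : Type} (Δ : Set (Sent35 P R)) : Type where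
  x : Tm3 P R
  y : Tm3 P R
  tag : Bool
  prf : Pr35 Δ (.someS x y)

/-- The type of a world. -/
def CanW.T {P R : Type} {Δ : Set (Sent35 P R)} (w : CanW Δ) (z : Tm3 P R) : Prop :=
  Pr35 Δ (.allS w.x z) ∨ Pr35 Δ (.allS w.y z)

theorem CanW.T_up {P R : Type} {Δ : Set (Sent35 P R)} {w : CanW Δ} {u v : Tm3 P R}
    (h : w.T u) (k : Pr35 Δ (.allS u v)) : w.T v :=
  h.imp (fun h => .barbara h k) (fun h => .barbara h k)

theorem CanW.T_some {P R : Type} {Δ : Set (Sent35 P R)} {w : CanW Δ} {u v : Tm3 P R}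
    (h : w.T u) (k : w.T v) : Pr35 Δ (.someS u v) := by
  have p := w.prf
  rcases h with h | h <;> rcases k with k | k
  · exact .darii (.some2 (.darii (.some1 p) h)) k
  · exact .darii (.some2 (.darii (.some2 p) h)) k
  · exact .darii (.some2 (.darii p h)) k
  · exact .darii (.some2 (.darii (.some1 (.some2 p)) h)) k

def canM {P R : Type} (Δ : Set (Sent35 P R)) : Model3 P R where
  W := CanW Δ
  nounI p := {w | w.T (.noun p)}
  verbI r w v := (∃ z, w.T (.allT r z) ∧ v.T z) ∨
    (v.tag = true ∧ v.x = v.y ∧ w.T (.someT r v.x))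

theorem can_truth {P R : Type} (Δ : Set (Sent35 P R))
    (hΔ : ∀ x, Pr35 Δ (.someS x x) ∨ ∀ y r, Pr35 Δ (.allS y (.allT r x))) (t : Tm3 P R) :
    ∀ w : CanW Δ, w ∈ Tm3.interp (canM Δ) t ↔ w.T t := by
  induction t with
  | noun p => intro w; exact Iff.rfl
  | allT r x ih =>
    intro w
    constructor
    · intro h
      rcases hΔ x with hx | hx
      · rcases h (⟨x, x, false, hx⟩ : CanW Δ) ((ih _).2 (Or.inl (.ax x))) with ⟨z, h1, h2⟩ | h
        · refine CanW.T_up h1 (.anti r ?_)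
          exact h2.elim id id
        · exact absurd h.1 (by simp)
      · exact Or.inl (hx _ _)
    · intro h v hv
      exact Or.inl ⟨x, h, (ih v).1 hv⟩
  | someT r x ih =>
    intro w
    constructor
    · rintro ⟨v, hv, h⟩
      have hv := (ih v).1 hv
      rcases h with ⟨z, h1, h2⟩ | ⟨_, h2, h3⟩
      · exact CanW.T_up h1 (.r2 r (CanW.T_some h2 hv))
      · refine CanW.T_up h3 (.r1 r ?_)
        unfold CanW.T at hv
        rw [← h2] at hv
        exact hv.elim id id
    · intro h
      exact ⟨(⟨x, x, true, .r3 r (CanW.T_some h h)⟩ : CanW Δ), (ih _).2 (Or.inl (.ax x)),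
        Or.inr ⟨rfl, rfl, h⟩⟩

theorem Pr35.complete {P R : Type} {Γ : Set (Sent35 P R)} {φ} (hφ : entails35 Γ φ) :
    Pr35 Γ φ := by
  by_contra hn
  obtain ⟨Δ, hΓ, hmax⟩ := zorn_subset_nonempty {S : Set (Sent35 P R) | ¬ Pr35 S φ} (by
    intro c hc hch hne
    refine ⟨⋃₀ c, ?_, fun s hs => Set.subset_sUnion_of_mem hs⟩
    intro h
    obtain ⟨F, hF, hs, h⟩ := h.fin
    obtain ⟨t, ht, hFt⟩ := hch.directedOn.exists_mem_subset_of_finite_of_subset_sUnion hne hF hs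
    exact hc ht (h.mono hFt)) Γ hn
  have hΔ : ¬ Pr35 Δ φ := hmax.prop
  have key : ∀ ψ, ψ ∈ Δ ∨ Pr35 (insert ψ Δ) φ := by
    intro ψ
    by_contra! h
    exact h.1 (hmax.le_of_ge (y := insert ψ Δ) h.2 (Set.subset_insert _ _) (Set.mem_insert _ _))
  have h1 : ∀ x, Pr35 Δ (.someS x x) ∨ ∀ y r, Pr35 Δ (.allS y (.allT r x)) := by
    intro x
    rcases key (.someS x x) with h | h
    · exact Or.inl (.hyp h)
    · refine Or.inr fun y r => ?_
      rcases key (.allS y (.allT r x)) with k | k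
      · exact .hyp k
      · exact absurd (.cases x y r h k) hΔ
  have h2 : ∀ x, Pr35 Δ (.someS x x) ∨ ∀ y, Pr35 Δ (.allS x y) := by
    intro x
    rcases key (.someS x x) with h | h
    · exact Or.inl (.hyp h)
    · refine Or.inr fun y => ?_
      rcases key (.allS x y) with k | k
      · exact .hyp k
      · exact absurd (.cases1 x y h k) hΔ
  have tr := can_truth Δ h1
  have hsat : ∀ ψ, (canM Δ).sat ψ ↔ Pr35 Δ ψ := by
    intro ψ
    cases ψ with
    | allS x y =>
      constructor
      · intro h
        rcases h2 x with hx | hx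
        · have := (tr y _).1 (h ((tr x (⟨x, x, false, hx⟩ : CanW Δ)).2 (Or.inl (.ax x))))
          exact this.elim id id
        · exact hx y
      · intro h w hw
        exact (tr y w).2 (CanW.T_up ((tr x w).1 hw) h)
    | someS x y =>
      constructor
      · rintro ⟨w, hx, hy⟩
        exact CanW.T_some ((tr x w).1 hx) ((tr y w).1 hy)
      · intro h
        exact ⟨(⟨x, y, false, h⟩ : CanW Δ), (tr x _).2 (Or.inl (.ax x)),
          (tr y _).2 (Or.inr (.ax y))⟩
  exact hΔ ((hsat φ).1 (hφ (canM Δ) fun ψ h => (hsat ψ).2 (.hyp (hΓ h))))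

/-- The L3.5 proof system is sound and complete: Γ ⊨ φ iff Γ ⊢ φ. -/
theorem stmt16 {P R : Type} (Γ : Set (Sent35 P R)) (φ : Sent35 P R) :
    entails35 Γ φ ↔ Pr35 Γ φ := by
  exact ⟨Pr35.complete, Pr35.sound⟩
end

section
/- The L4.5⁺ proof system is sound and complete: for any L4.5⁺ theory Γ and sentence φ, Γ ⊨ φ if and only if Γ ⊢ φ. -/
/-- Terms of L4.5: nouns, (r all x), and complements x̄. -/
inductive Tm4 (P R : Type) : Type
  | noun : P → Tm4 P R
  | allT : R → Tm4 P R → Tm4 P R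
  | comp : Tm4 P R → Tm4 P R

/-- Sentences of L4.5⁺: [x₁,…,xₙ] and ⟨x₁,…,xₙ⟩ for n ≥ 1; a sentence is encoded by
its first term together with the list of its remaining terms, so that the list of
terms is always nonempty. -/
inductive Sent45 (P R : Type) : Type
  | box : Tm4 P R → List (Tm4 P R) → Sent45 P R
  | dia : Tm4 P R → List (Tm4 P R) → Sent45 P R

structure Model4 (P R : Type) where
  W : Type
  nounI : P → Set W
  verbI : R → W → W → Prop

def Tm4.interp {P R : Type} (M : Model4 P R) : Tm4 P R → Set M.W
  | .noun p => M.nounI p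
  | .allT r x => {m | ∀ n ∈ Tm4.interp M x, M.verbI r m n}
  | .comp x => (Tm4.interp M x)ᶜ

/-- M ⊨ [x₁,…,xₙ] iff ⟦x₁⟧ ∩ … ∩ ⟦xₙ⟧ = ∅; M ⊨ ⟨x₁,…,xₙ⟩ iff the intersection is
nonempty. -/
def Model4.sat {P R : Type} (M : Model4 P R) : Sent45 P R → Prop
  | .box x xs => {m | ∀ t ∈ x :: xs, m ∈ Tm4.interp M t} = ∅
  | .dia x xs => Set.Nonempty {m | ∀ t ∈ x :: xs, m ∈ Tm4.interp M t}

def entails45 {P R : Type} (Γ : Set (Sent45 P R)) (φ : Sent45 P R) : Prop :=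
  ∀ M : Model4 P R, (∀ ψ ∈ Γ, M.sat ψ) → M.sat φ

/-- The L4.5⁺ proof system: (Axiom), (Res), (Rel), (Structural), (EFQ), and (RAA). -/
inductive Pr45 {P R : Type} : Set (Sent45 P R) → Sent45 P R → Prop
  | hyp {Γ : Set (Sent45 P R)} {φ} : φ ∈ Γ → Pr45 Γ φ
  | ax {Γ : Set (Sent45 P R)} (x : Tm4 P R) : Pr45 Γ (Sent45.box x [Tm4.comp x])
  | res {Γ : Set (Sent45 P R)} {x w : Tm4 P R} {ys zs ws : List (Tm4 P R)} :
      Pr45 Γ (Sent45.box x ys) → Pr45 Γ (Sent45.box (Tm4.comp x) zs) →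
      ys ++ zs = w :: ws → Pr45 Γ (Sent45.box w ws)
  | rel {Γ : Set (Sent45 P R)} (r : R) {xs : List (Tm4 P R)} {xn u w : Tm4 P R}
      {us ws : List (Tm4 P R)} :
      Pr45 Γ (Sent45.box u us) →
      u :: us = xs.map Tm4.comp ++ [xn] →
      xs.map (Tm4.allT r) ++ [Tm4.comp (Tm4.allT r xn)] = w :: ws →
      Pr45 Γ (Sent45.box w ws)
  | structural {Γ : Set (Sent45 P R)} {x y : Tm4 P R} {xs ys : List (Tm4 P R)} :
      Pr45 Γ (Sent45.box x xs) → (∀ t ∈ x :: xs, t ∈ y :: ys) →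
      Pr45 Γ (Sent45.box y ys)
  | efq {Γ : Set (Sent45 P R)} {y x : Tm4 P R} {ys xs : List (Tm4 P R)} :
      Pr45 Γ (Sent45.dia y ys) → Pr45 Γ (Sent45.box y ys) → Pr45 Γ (Sent45.box x xs)
  | raa {Γ : Set (Sent45 P R)} {x y : Tm4 P R} {xs ys : List (Tm4 P R)} :
      Pr45 (insert (Sent45.box x xs) Γ) (Sent45.dia y ys) →
      Pr45 (insert (Sent45.box x xs) Γ) (Sent45.box y ys) →
      Pr45 Γ (Sent45.dia x xs)

namespace L45

variable {P R : Type}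

/-- Soundness. -/
theorem sound {Γ : Set (Sent45 P R)} {φ : Sent45 P R} (h : Pr45 Γ φ) : entails45 Γ φ := by
  induction h with
  | hyp h => intro M hM; exact hM _ h
  | ax x =>
    intro M hM
    simp only [Model4.sat, Set.eq_empty_iff_forall_notMem, Set.mem_setOf_eq]
    intro m hm
    have h1 := hm x (by simp)
    have h2 := hm (Tm4.comp x) (by simp)
    exact h2 h1
  | @res Γ x w ys zs ws h1 h2 e ih1 ih2 =>
    intro M hM
    have i1 := ih1 M hM
    have i2 := ih2 M hM
    simp only [Model4.sat, Set.eq_empty_iff_forall_notMem, Set.mem_setOf_eq] at *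
    intro m hm
    rw [← e] at hm
    by_cases hx : m ∈ Tm4.interp M x
    · apply i1 m
      intro t ht
      rcases List.mem_cons.1 ht with rfl | ht
      · exact hx
      · exact hm t (List.mem_append_left _ ht)
    · apply i2 m
      intro t ht
      rcases List.mem_cons.1 ht with rfl | ht
      · exact hx
      · exact hm t (List.mem_append_right _ ht)
  | @rel Γ r xs xn u w us ws h e1 e2 ih =>
    intro M hM
    have i := ih M hM
    simp only [Model4.sat, Set.eq_empty_iff_forall_notMem, Set.mem_setOf_eq] at *
    intro m hm
    rw [← e2] at hm
    have h1 : m ∉ Tm4.interp M (Tm4.allT r xn) := hm (Tm4.comp (Tm4.allT r xn)) (by simp)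
    apply h1
    intro n hn
    by_contra hr
    apply i n
    rw [e1]
    intro t ht
    rcases List.mem_append.1 ht with ht | ht
    · obtain ⟨y, hy, rfl⟩ := List.mem_map.1 ht
      intro hny
      exact hr (hm (Tm4.allT r y) (List.mem_append_left _ (List.mem_map_of_mem hy)) n hny)
    · rw [List.mem_singleton.1 ht]; exact hn
  | structural h hs ih =>
    intro M hM
    have i := ih M hM
    simp only [Model4.sat, Set.eq_empty_iff_forall_notMem, Set.mem_setOf_eq] at *
    intro m hm
    exact i m (fun t ht => hm t (hs t ht))
  | efq h1 h2 ih1 ih2 =>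
    intro M hM
    have i1 := ih1 M hM
    have i2 := ih2 M hM
    simp only [Model4.sat] at i1 i2
    rw [i2] at i1
    exact absurd i1 Set.not_nonempty_empty
  | @raa Γ x y xs ys h1 h2 ih1 ih2 =>
    intro M hM
    by_contra hc
    have hb : M.sat (Sent45.box x xs) := by
      simp only [Model4.sat] at *
      exact Set.not_nonempty_iff_eq_empty.1 hc
    have hM' : ∀ ψ ∈ insert (Sent45.box x xs) Γ, M.sat ψ := by
      rintro ψ (rfl | hψ)
      · exact hb
      · exact hM _ hψ
    have i1 := ih1 M hM'
    have i2 := ih2 M hM'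
    simp only [Model4.sat] at i1 i2
    rw [i2] at i1
    exact absurd i1 Set.not_nonempty_empty

/-- A set of terms is consistent when no finite list of its members is provably empty. -/
def Con (Γ : Set (Sent45 P R)) (S : Set (Tm4 P R)) : Prop :=
  ∀ x xs, (∀ t ∈ x :: xs, t ∈ S) → ¬ Pr45 Γ (Sent45.box x xs)

/-- Complete consistent sets of terms. -/
def MCon (Γ : Set (Sent45 P R)) (S : Set (Tm4 P R)) : Prop :=
  Con Γ S ∧ ∀ x, x ∈ S ∨ Tm4.comp x ∈ S

theorem list_chain {c : Set (Set (Tm4 P R))} (hc : IsChain (· ⊆ ·) c) (hne : c.Nonempty)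
    (l : List (Tm4 P R)) (h : ∀ t ∈ l, t ∈ ⋃₀ c) : ∃ S ∈ c, ∀ t ∈ l, t ∈ S := by
  induction l with
  | nil => obtain ⟨S, hS⟩ := hne; exact ⟨S, hS, by simp⟩
  | cons a l ih =>
    obtain ⟨S, hS, h1⟩ := ih (fun t ht => h t (List.mem_cons_of_mem _ ht))
    obtain ⟨T, hT, h2⟩ := h a (by simp)
    rcases hc.total hS hT with hST | hST
    · refine ⟨T, hT, ?_⟩
      intro t ht
      rcases List.mem_cons.1 ht with rfl | ht
      · exact h2
      · exact hST (h1 t ht)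
    · refine ⟨S, hS, ?_⟩
      intro t ht
      rcases List.mem_cons.1 ht with rfl | ht
      · exact hST h2
      · exact h1 t ht

/-- Lindenbaum lemma for nonempty consistent sets of terms. -/
theorem lindenbaum (Γ : Set (Sent45 P R)) (S : Set (Tm4 P R)) (hS : Con Γ S)
    (hne : S.Nonempty) : ∃ T, S ⊆ T ∧ MCon Γ T := by
  classical
  obtain ⟨T, hST, hT⟩ := zorn_subset_nonempty {T | Con Γ T} (by
    intro c hc hch hcne
    refine ⟨⋃₀ c, ?_, fun s hs => Set.subset_sUnion_of_mem hs⟩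
    intro x xs hx
    obtain ⟨U, hU, h⟩ := list_chain hch hcne _ hx
    exact hc hU x xs h) S hS
  refine ⟨T, hST, hT.prop, ?_⟩
  intro x
  by_contra hx
  push Not at hx
  obtain ⟨z, hz⟩ := hne
  have hz : z ∈ T := hST hz
  have key : ∀ y, y ∉ T → ∃ l : List (Tm4 P R), (∀ t ∈ l, t ∈ T) ∧
      Pr45 Γ (Sent45.box y l) := by
    intro y hy
    have hn : ¬ Con Γ (insert y T) := fun h =>
      hy (hT.le_of_ge h (Set.subset_insert _ _) (Set.mem_insert _ _))
    unfold Con at hn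
    push Not at hn
    obtain ⟨u, us, hu, hp⟩ := hn
    refine ⟨(u :: us).filter (fun t => t ≠ y), ?_, ?_⟩
    · intro t ht
      rw [List.mem_filter] at ht
      have h2 : t ≠ y := by simpa using ht.2
      exact (hu t ht.1).resolve_left h2
    · refine Pr45.structural hp ?_
      intro t ht
      by_cases hty : t = y
      · simp [hty]
      · refine List.mem_cons_of_mem _ (List.mem_filter.2 ⟨ht, by simpa using hty⟩)
  obtain ⟨l1, h1, p1⟩ := key x hx.1
  obtain ⟨l2, h2, p2⟩ := key (Tm4.comp x) hx.2
  have p1' : Pr45 Γ (Sent45.box x (z :: l1)) := Pr45.structural p1 (by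
    intro t ht
    simp only [List.mem_cons] at ht ⊢
    tauto)
  have p3 : Pr45 Γ (Sent45.box z (l1 ++ l2)) := Pr45.res p1' p2 rfl
  refine hT.prop _ _ ?_ p3
  intro t ht
  simp only [List.mem_cons, List.mem_append] at ht
  rcases ht with rfl | ht | ht
  · exact hz
  · exact h1 t ht
  · exact h2 t ht

theorem MCon.comp_iff {Γ : Set (Sent45 P R)} {S : Set (Tm4 P R)} (h : MCon Γ S)
    (x : Tm4 P R) : Tm4.comp x ∈ S ↔ x ∉ S := by
  constructor
  · intro h1 h2
    refine h.1 x [Tm4.comp x] ?_ (Pr45.ax x)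
    intro t ht
    simp only [List.mem_cons, List.not_mem_nil, or_false] at ht
    rcases ht with rfl | rfl <;> assumption
  · intro h1
    exact (h.2 x).resolve_left h1

/-- The canonical model. -/
def canon (Γ : Set (Sent45 P R)) : Model4 P R where
  W := {S : Set (Tm4 P R) // MCon Γ S}
  nounI p := {S | Tm4.noun p ∈ S.1}
  verbI r S T := ∃ x, Tm4.allT r x ∈ S.1 ∧ x ∈ T.1

theorem list_rel (S : Set (Tm4 P R)) (r : R) (x : Tm4 P R) (l : List (Tm4 P R))
    (h : ∀ t ∈ l, t = x ∨ ∃ y, Tm4.allT r y ∈ S ∧ t = Tm4.comp y) :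
    ∃ ys : List (Tm4 P R), (∀ y ∈ ys, Tm4.allT r y ∈ S) ∧
      ∀ t ∈ l, t ∈ ys.map Tm4.comp ++ [x] := by
  induction l with
  | nil => exact ⟨[], by simp, by simp⟩
  | cons a l ih =>
    obtain ⟨ys, h1, h2⟩ := ih (fun t ht => h t (List.mem_cons_of_mem _ ht))
    rcases h a (by simp) with rfl | ⟨y, hy, rfl⟩
    · refine ⟨ys, h1, ?_⟩
      intro t ht
      rcases List.mem_cons.1 ht with rfl | ht
      · simp
      · exact h2 t ht
    · refine ⟨y :: ys, ?_, ?_⟩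
      · intro t ht
        rcases List.mem_cons.1 ht with rfl | ht
        · exact hy
        · exact h1 t ht
      · intro t ht
        rcases List.mem_cons.1 ht with rfl | ht
        · simp
        · exact List.mem_cons_of_mem _ (h2 t ht)

theorem truth (Γ : Set (Sent45 P R)) (t : Tm4 P R) :
    ∀ S : {S : Set (Tm4 P R) // MCon Γ S}, S ∈ Tm4.interp (canon Γ) t ↔ t ∈ S.1 := by
  induction t with
  | noun p => intro S; exact Iff.rfl
  | comp x ih =>
    intro S
    rw [S.2.comp_iff, ← ih S]
    exact Iff.rfl
  | allT r x ih =>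
    intro S
    constructor
    · intro hS
      by_contra hx
      have hcx := (S.2.comp_iff _).2 hx
      have hcon : Con Γ {t | t = x ∨ ∃ y, Tm4.allT r y ∈ S.1 ∧ t = Tm4.comp y} := by
        intro u us hu hp
        obtain ⟨ys, h1, h2⟩ := list_rel S.1 r x (u :: us) hu
        obtain ⟨v, vs, hv⟩ : ∃ v vs, ys.map Tm4.comp ++ [x] = v :: vs :=
          List.exists_cons_of_ne_nil (by simp)
        obtain ⟨w, ws, hw⟩ : ∃ w ws,
            ys.map (Tm4.allT r) ++ [Tm4.comp (Tm4.allT r x)] = w :: ws :=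
          List.exists_cons_of_ne_nil (by simp)
        rw [hv] at h2
        have p1 : Pr45 Γ (Sent45.box v vs) := Pr45.structural hp h2
        have p2 : Pr45 Γ (Sent45.box w ws) := Pr45.rel r p1 hv.symm hw
        refine S.2.1 w ws ?_ p2
        rw [← hw]
        intro t ht
        rcases List.mem_append.1 ht with ht | ht
        · obtain ⟨y, hy, rfl⟩ := List.mem_map.1 ht
          exact h1 y hy
        · rw [List.mem_singleton.1 ht]; exact hcx
      obtain ⟨T, hT, hm⟩ := lindenbaum Γ _ hcon ⟨x, Or.inl rfl⟩
      obtain ⟨y, hy1, hy2⟩ := hS ⟨T, hm⟩ ((ih ⟨T, hm⟩).2 (hT (Or.inl rfl)))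
      exact (hm.comp_iff y).1 (hT (Or.inr ⟨y, hy1, rfl⟩)) hy2
    · intro h T hT
      exact ⟨x, h, (ih T).1 hT⟩

theorem canon_dia (Γ : Set (Sent45 P R)) (x : Tm4 P R) (xs : List (Tm4 P R))
    (h : ¬ Pr45 Γ (Sent45.box x xs)) : (canon Γ).sat (Sent45.dia x xs) := by
  have hcon : Con Γ {t | t ∈ x :: xs} := fun u us hu hp => h (Pr45.structural hp hu)
  obtain ⟨T, hT, hm⟩ := lindenbaum Γ _ hcon ⟨x, List.mem_cons_self⟩
  exact ⟨⟨T, hm⟩, fun t ht => (truth Γ t ⟨T, hm⟩).2 (hT ht)⟩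

theorem canon_sat (Γ : Set (Sent45 P R))
    (h : ∀ y ys, Sent45.dia y ys ∈ Γ → ¬ Pr45 Γ (Sent45.box y ys)) :
    ∀ ψ ∈ Γ, (canon Γ).sat ψ := by
  intro ψ hψ
  cases ψ with
  | box x xs =>
    simp only [Model4.sat, Set.eq_empty_iff_forall_notMem, Set.mem_setOf_eq]
    intro S hS
    exact S.2.1 x xs (fun t ht => (truth Γ t S).1 (hS t ht)) (Pr45.hyp hψ)
  | dia x xs => exact canon_dia Γ x xs (h x xs hψ)

theorem complete (Γ : Set (Sent45 P R)) (φ : Sent45 P R) (h : entails45 Γ φ) :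
    Pr45 Γ φ := by
  by_contra hn
  cases φ with
  | box x xs =>
    have h1 := h (canon Γ) (canon_sat Γ (fun y ys hd hb => hn (Pr45.efq (Pr45.hyp hd) hb)))
    have h2 := canon_dia Γ x xs hn
    simp only [Model4.sat] at h1 h2
    rw [h1] at h2
    exact Set.not_nonempty_empty h2
  | dia x xs =>
    have hs := canon_sat (insert (Sent45.box x xs) Γ)
      (fun y ys hd hb => hn (Pr45.raa (Pr45.hyp hd) hb))
    have h1 := h _ (fun ψ hψ => hs ψ (Set.mem_insert_of_mem _ hψ))
    have h2 := hs _ (Set.mem_insert _ _)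
    simp only [Model4.sat] at h1 h2
    rw [h2] at h1
    exact Set.not_nonempty_empty h1

end L45

/-- The L4.5⁺ proof system is sound and complete: Γ ⊨ φ iff Γ ⊢ φ. -/
theorem stmt19 {P R : Type} (Γ : Set (Sent45 P R)) (φ : Sent45 P R) :
    entails45 Γ φ ↔ Pr45 Γ φ := by
  exact ⟨L45.complete Γ φ, L45.sound⟩
end
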